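/- Fix a coefficient α ≥ 1 and an even number of agents n ≥ 4. In the private-locations setting, no deterministic anonymous strategyproof mechanism is r-approximate under the maximum cost objective for any r < α. -/

import Mathlib

open scoped BigOperators

noncomputable section

/-- A location profile of `n` agents on the line. -/
abbrev Loc (n : ℕ) := Fin n → ℝ

/-- A preference profile: `true` means the agent prefers facility `F₁`,
`false` means the agent prefers facility `F₂`. -/
abbrev Pref (n : ℕ) := Fin n → Bool

/-- All agent locations lie in the unit interval `[0,1]`. -/
def validLoc {n : ℕ} (x : Loc n) : Prop := ∀ i, x i ∈ Set.Icc (0:ℝ) 1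

/-- The pair of facility locations lies in `[0,1]²`. -/
def inBox (y : ℝ × ℝ) : Prop := y.1 ∈ Set.Icc (0:ℝ) 1 ∧ y.2 ∈ Set.Icc (0:ℝ) 1

/-- The location of the facility indexed by `b` (`true` = `F₁`, `false` = `F₂`). -/
def facLoc (y : ℝ × ℝ) (b : Bool) : ℝ := if b then y.1 else y.2

/-- Cost of an agent located at `xi` whose preferred facility is `σi`:
`min(|xi − y_{σi}|, α·|xi − y_{3−σi}|)`. -/
def cost (α xi : ℝ) (σi : Bool) (y : ℝ × ℝ) : ℝ :=
  min |xi - facLoc y σi| (α * |xi - facLoc y (!σi)|)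

/-- Utility of an agent located at `xi` whose preferred facility is `σi`:
`max(1 − |xi − y_{σi}|, (1 − |xi − y_{3−σi}|)/α)`. -/
def util (α xi : ℝ) (σi : Bool) (y : ℝ × ℝ) : ℝ :=
  max (1 - |xi - facLoc y σi|) ((1 - |xi - facLoc y (!σi)|) / α)

/-- Total cost. -/
def SC {n : ℕ} (α : ℝ) (x : Loc n) (σ : Pref n) (y : ℝ × ℝ) : ℝ :=
  ∑ i, cost α (x i) (σ i) y

/-- Maximum cost. -/
def BC {n : ℕ} (α : ℝ) (x : Loc n) (σ : Pref n) (y : ℝ × ℝ) : ℝ :=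
  ⨆ i, cost α (x i) (σ i) y

/-- Total utility. -/
def SU {n : ℕ} (α : ℝ) (x : Loc n) (σ : Pref n) (y : ℝ × ℝ) : ℝ :=
  ∑ i, util α (x i) (σ i) y

/-- Minimum utility. -/
def BU {n : ℕ} (α : ℝ) (x : Loc n) (σ : Pref n) (y : ℝ × ℝ) : ℝ :=
  ⨅ i, util α (x i) (σ i) y

/-- Optimal (minimal) total cost over `y ∈ [0,1]²`. -/
def optSC {n : ℕ} (α : ℝ) (x : Loc n) (σ : Pref n) : ℝ :=
  sInf {c | ∃ y, inBox y ∧ c = SC α x σ y}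

/-- Optimal (minimal) maximum cost over `y ∈ [0,1]²`. -/
def optBC {n : ℕ} (α : ℝ) (x : Loc n) (σ : Pref n) : ℝ :=
  sInf {c | ∃ y, inBox y ∧ c = BC α x σ y}

/-- Optimal (maximal) total utility over `y ∈ [0,1]²`. -/
def optSU {n : ℕ} (α : ℝ) (x : Loc n) (σ : Pref n) : ℝ :=
  sSup {c | ∃ y, inBox y ∧ c = SU α x σ y}

/-- Optimal (maximal) minimum utility over `y ∈ [0,1]²`. -/
def optBU {n : ℕ} (α : ℝ) (x : Loc n) (σ : Pref n) : ℝ :=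
  sSup {c | ∃ y, inBox y ∧ c = BU α x σ y}

/-- Strategyproofness in the private-preferences setting (cost version):
no agent can strictly decrease his cost by misreporting his preference. -/
def SPprefCost {n : ℕ} (α : ℝ) (f : Loc n → Pref n → ℝ × ℝ) : Prop :=
  ∀ x : Loc n, validLoc x → ∀ σ : Pref n, ∀ i : Fin n, ∀ b : Bool,
    cost α (x i) (σ i) (f x σ) ≤ cost α (x i) (σ i) (f x (Function.update σ i b))

/-- Strategyproofness in the private-preferences setting (utility version):
no agent can strictly increase his utility by misreporting his preference. -/
def SPprefUtil {n : ℕ} (α : ℝ) (f : Loc n → Pref n → ℝ × ℝ) : Prop :=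
  ∀ x : Loc n, validLoc x → ∀ σ : Pref n, ∀ i : Fin n, ∀ b : Bool,
    util α (x i) (σ i) (f x (Function.update σ i b)) ≤ util α (x i) (σ i) (f x σ)

/-- Group strategyproofness in the private-preferences setting (cost version):
for every joint misreport of preferences, some deviating agent does not
strictly decrease his cost. -/
def GSPprefCost {n : ℕ} (α : ℝ) (f : Loc n → Pref n → ℝ × ℝ) : Prop :=
  ∀ x : Loc n, validLoc x → ∀ σ σ' : Pref n, σ' ≠ σ →
    ∃ i : Fin n, σ' i ≠ σ i ∧
      cost α (x i) (σ i) (f x σ) ≤ cost α (x i) (σ i) (f x σ')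

/-- Group strategyproofness in the private-preferences setting (utility version). -/
def GSPprefUtil {n : ℕ} (α : ℝ) (f : Loc n → Pref n → ℝ × ℝ) : Prop :=
  ∀ x : Loc n, validLoc x → ∀ σ σ' : Pref n, σ' ≠ σ →
    ∃ i : Fin n, σ' i ≠ σ i ∧
      util α (x i) (σ i) (f x σ') ≤ util α (x i) (σ i) (f x σ)

/-- Strategyproofness in the private-locations setting (cost version). -/
def SPlocCost {n : ℕ} (α : ℝ) (f : Loc n → Pref n → ℝ × ℝ) : Prop :=
  ∀ x : Loc n, validLoc x → ∀ σ : Pref n, ∀ i : Fin n, ∀ z ∈ Set.Icc (0:ℝ) 1,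
    cost α (x i) (σ i) (f x σ) ≤ cost α (x i) (σ i) (f (Function.update x i z) σ)

/-- Strategyproofness in the private-locations setting (utility version). -/
def SPlocUtil {n : ℕ} (α : ℝ) (f : Loc n → Pref n → ℝ × ℝ) : Prop :=
  ∀ x : Loc n, validLoc x → ∀ σ : Pref n, ∀ i : Fin n, ∀ z ∈ Set.Icc (0:ℝ) 1,
    util α (x i) (σ i) (f (Function.update x i z) σ) ≤ util α (x i) (σ i) (f x σ)

/-- Group strategyproofness in the private-locations setting (cost version). -/
def GSPlocCost {n : ℕ} (α : ℝ) (f : Loc n → Pref n → ℝ × ℝ) : Prop :=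
  ∀ x : Loc n, validLoc x → ∀ σ : Pref n, ∀ x' : Loc n, validLoc x' → x' ≠ x →
    ∃ i : Fin n, x' i ≠ x i ∧
      cost α (x i) (σ i) (f x σ) ≤ cost α (x i) (σ i) (f x' σ)

/-- Anonymity: the output is invariant under simultaneous permutations of the agents. -/
def Anonymous {n : ℕ} (f : Loc n → Pref n → ℝ × ℝ) : Prop :=
  ∀ (x : Loc n) (σ : Pref n) (π : Equiv.Perm (Fin n)), f (x ∘ π) (σ ∘ π) = f x σ

/-- Mechanism 1: `F₁` at `(lt+lb)/2` and `F₂` at `(rt+rb)/2`, where `lt`,`rt` are the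
extreme agent locations, `cen` their midpoint, `lb` (`rb`) the agent location closest
to `cen` from the left (right). -/
def mech1 {n : ℕ} (x : Loc n) : ℝ × ℝ :=
  ((⨅ i, x i) / 2 + sSup {z | (∃ i, x i = z) ∧ z ≤ ((⨅ i, x i) + (⨆ i, x i)) / 2} / 2,
   (⨆ i, x i) / 2 + sInf {z | (∃ i, x i = z) ∧ ((⨅ i, x i) + (⨆ i, x i)) / 2 ≤ z} / 2)

/-- Mechanism 2: `F₁` at the midpoint of the extreme locations of agents reporting
preference `F₁`, and likewise for `F₂`. -/
def mech2 {n : ℕ} (x : Loc n) (σ : Pref n) : ℝ × ℝ :=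
  ((sInf {z | ∃ i, σ i = true ∧ x i = z} + sSup {z | ∃ i, σ i = true ∧ x i = z}) / 2,
   (sInf {z | ∃ i, σ i = false ∧ x i = z} + sSup {z | ∃ i, σ i = false ∧ x i = z}) / 2)

/-- Mechanism 3: both facilities at `1/2`. -/
def mech3 : ℝ × ℝ := (1/2, 1/2)

/-- Mechanism 4: facilities at the two extreme reported locations. -/
def mech4 {n : ℕ} (x : Loc n) : ℝ × ℝ := (⨅ i, x i, ⨆ i, x i)

end

lemma cost_nonneg {α : ℝ} (hα : 0 ≤ α) (t : ℝ) (b : Bool) (y : ℝ × ℝ) : 0 ≤ cost α t b y :=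
  le_min (abs_nonneg _) (mul_nonneg hα (abs_nonneg _))

lemma cost_true (α t : ℝ) (y : ℝ × ℝ) :
    cost α t true y = min |t - y.1| (α * |t - y.2|) := by
  simp [cost, facLoc]

lemma cost_true_le_left (α t : ℝ) (y : ℝ × ℝ) : cost α t true y ≤ |t - y.1| := by
  rw [cost_true]; exact min_le_left _ _

lemma cost_true_le_right (α t : ℝ) (y : ℝ × ℝ) : cost α t true y ≤ α * |t - y.2| := by
  rw [cost_true]; exact min_le_right _ _

lemma BC_nonneg {n : ℕ} {α : ℝ} (hα : 0 ≤ α) (x : Loc n) (σ : Pref n) (y : ℝ × ℝ) :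
    0 ≤ BC α x σ y :=
  Real.iSup_nonneg fun _ => cost_nonneg hα _ _ _

lemma optBC_nonneg {n : ℕ} {α : ℝ} (hα : 0 ≤ α) (x : Loc n) (σ : Pref n) :
    0 ≤ optBC α x σ := by
  apply Real.sInf_nonneg
  rintro c ⟨y, -, rfl⟩
  exact BC_nonneg hα x σ y

lemma optBC_le {n : ℕ} {α : ℝ} (hα : 0 ≤ α) {x : Loc n} {σ : Pref n} {y : ℝ × ℝ}
    (hy : inBox y) : optBC α x σ ≤ BC α x σ y := by
  refine csInf_le ⟨0, ?_⟩ ⟨y, hy, rfl⟩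
  rintro c ⟨y, -, rfl⟩
  exact BC_nonneg hα x σ y

lemma cost_le_BC {n : ℕ} (α : ℝ) (x : Loc n) (σ : Pref n) (y : ℝ × ℝ) (i : Fin n) :
    cost α (x i) (σ i) y ≤ BC α x σ y :=
  le_ciSup (f := fun i => cost α (x i) (σ i) y) (Set.finite_range _).bddAbove i

/-- The outcomes `g p q` on the profiles with two movable agents at `p` and `q` and all other
agents at `1 - ε` or `1`, where everybody prefers `F₁`: the facts used about a symmetric
strategyproof mechanism with approximation ratio `r`. -/
structure PairMechanism (α r ε : ℝ) (g : ℝ → ℝ → ℝ × ℝ) : Prop where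
  inBox : ∀ p q, inBox (g p q)
  symm : ∀ p q, g p q = g q p
  cost_le : ∀ p ∈ Set.Icc (0:ℝ) 1, ∀ q ∈ Set.Icc (0:ℝ) 1, ∀ u ∈ Set.Icc (0:ℝ) 1,
    cost α p true (g p q) ≤ cost α p true (g u q)
  approx : ∀ p ∈ Set.Icc (0:ℝ) 1, ∀ q ∈ Set.Icc (0:ℝ) 1, ∀ y B, _root_.inBox y →
    (∀ t, t = p ∨ t = q ∨ t = 1 - ε ∨ t = 1 → cost α t true y ≤ B) →
    ∀ t, t = p ∨ t = q ∨ t = 1 - ε ∨ t = 1 → cost α t true (g p q) ≤ r * B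

namespace PairMechanism

variable {α r ε : ℝ} {g : ℝ → ℝ → ℝ × ℝ}

/-- A close pair, far from the rest, is served by `F₂`. -/
lemma cost_eq_of_near (hg : PairMechanism α r ε g) (hα : 1 ≤ α) (hr : r < α)
    (hε : 0 < ε) (hαε : α * ε ≤ 1 / 4) {p q : ℝ} (hp : p ∈ Set.Icc (0:ℝ) (1 / 4))
    (hq : q ∈ Set.Icc (0:ℝ) (1 / 4)) (hpq : α * |p - q| ≤ ε) :
    cost α p true (g p q) = α * |p - (g p q).2| := by
  obtain ⟨hp0, hp1⟩ := hp
  obtain ⟨hq0, hq1⟩ := hq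
  have hε1 : ε ≤ 1 / 4 := by nlinarith
  have key := hg.approx p ⟨hp0, by linarith⟩ q ⟨hq0, by linarith⟩ (1 - ε / 2, (p + q) / 2) (ε / 2)
    ⟨⟨by dsimp only; linarith, by dsimp only; linarith⟩,
      ⟨by dsimp only; linarith, by dsimp only; linarith⟩⟩ (by
      rintro t (rfl | rfl | rfl | rfl)
      · refine (cost_true_le_right _ _ _).trans ?_
        rw [show t - (t + q) / 2 = (t - q) / 2 by ring, abs_div, abs_two]; linarith
      · refine (cost_true_le_right _ _ _).trans ?_
        rw [show t - (p + t) / 2 = -((p - t) / 2) by ring, abs_neg, abs_div, abs_two]; linarith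
      · refine (cost_true_le_left _ _ _).trans (abs_le.2 ⟨?_, ?_⟩) <;> dsimp only <;> linarith
      · refine (cost_true_le_left _ _ _).trans (abs_le.2 ⟨?_, ?_⟩) <;> dsimp only <;> linarith)
  have hrα : r * (ε / 2) < α * (ε / 2) := by nlinarith
  have hp' := key p (by simp)
  have hc := key (1 - ε) (by simp)
  have hd := key 1 (by simp)
  generalize g p q = y at *
  have hy : 1 - ε - α * (ε / 2) ≤ y.1 := by
    by_contra! hlt
    rw [cost_true, min_le_iff] at hc hd
    have hc1 : α * |1 - ε - y.2| ≤ r * (ε / 2) :=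
      hc.resolve_left fun h => by linarith [le_abs_self (1 - ε - y.1)]
    have hd1 : α * |1 - y.2| ≤ r * (ε / 2) :=
      hd.resolve_left fun h => by linarith [le_abs_self (1 - y.1)]
    have := abs_sub_abs_le_abs_sub (1 - y.2) (1 - ε - y.2)
    nlinarith [le_abs_self (1 - y.2), neg_abs_le (1 - ε - y.2)]
  rw [cost_true] at hp' ⊢
  rw [min_le_iff] at hp'
  refine min_eq_right ?_
  have h1 := neg_abs_le (p - y.1)
  rcases hp' with h | h <;> nlinarith

/-- A spread-out pair, far from the rest, is served by `F₁`. -/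
lemma cost_eq_of_far (hg : PairMechanism α r ε g) (hα : 1 ≤ α) (hr : r < α)
    (hε : 0 < ε) {p q : ℝ} (hp : p ∈ Set.Icc (0:ℝ) (1 / 4))
    (hq : q ∈ Set.Icc (0:ℝ) (1 / 4)) (hpq : α * ε ≤ |p - q|) (hαpq : α * |p - q| ≤ 1 / 4) :
    cost α p true (g p q) = |p - (g p q).1| ∧ |p - (g p q).1| ≤ r * (|p - q| / 2) := by
  obtain ⟨hp0, hp1⟩ := hp
  obtain ⟨hq0, hq1⟩ := hq
  have hs1 : |p - q| ≤ 1 / 4 := by nlinarith [abs_nonneg (p - q)]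
  have hεs : ε ≤ |p - q| := by nlinarith
  have key := hg.approx p ⟨hp0, by linarith⟩ q ⟨hq0, by linarith⟩ ((p + q) / 2, 1 - ε / 2)
    (|p - q| / 2)
    ⟨⟨by dsimp only; linarith, by dsimp only; linarith⟩,
      ⟨by dsimp only; linarith, by dsimp only; linarith⟩⟩ (by
      rintro t (rfl | rfl | rfl | rfl)
      · refine (cost_true_le_left _ _ _).trans ?_
        rw [show t - (t + q) / 2 = (t - q) / 2 by ring, abs_div, abs_two]
      · refine (cost_true_le_left _ _ _).trans ?_
        rw [show t - (p + t) / 2 = -((p - t) / 2) by ring, abs_neg, abs_div, abs_two]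
      · refine (cost_true_le_right _ _ _).trans ?_
        rw [show 1 - ε - (1 - ε / 2) = -(ε / 2) by ring, abs_neg, abs_of_pos (by linarith)]
        linarith
      · refine (cost_true_le_right _ _ _).trans ?_
        rw [show 1 - (1 - ε / 2) = ε / 2 by ring, abs_of_pos (by linarith)]
        linarith)
  have hp' := key p (by simp)
  have hq' := key q (by simp)
  have hd := key 1 (by simp)
  have hs0 : 0 < |p - q| := hε.trans_le hεs
  generalize g p q = y at *
  set s := |p - q| with hs
  have hrα : r * (s / 2) < α * (s / 2) := by nlinarith
  rw [cost_true, min_le_iff] at hp' hq' hd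
  have hy1 : y.1 ≤ 1 / 4 + α * (s / 2) := by
    by_contra! hlt
    have hp2 : α * |p - y.2| ≤ r * (s / 2) :=
      hp'.resolve_left fun h => by linarith [neg_abs_le (p - y.1)]
    have hq2 : α * |q - y.2| ≤ r * (s / 2) :=
      hq'.resolve_left fun h => by linarith [neg_abs_le (q - y.1)]
    have := abs_sub_le p y.2 q
    rw [abs_sub_comm y.2 q] at this
    nlinarith
  have hd2 : α * |1 - y.2| ≤ r * (s / 2) :=
    hd.resolve_left fun h => by linarith [le_abs_self (1 - y.1)]
  have hd3 : |1 - y.2| ≤ s / 2 := by nlinarith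
  have hy2 : 1 / 2 ≤ |p - y.2| := by linarith [le_abs_self (1 - y.2), neg_abs_le (p - y.2)]
  have hfar : r * (s / 2) < α * |p - y.2| := by nlinarith
  have hp2 : |p - y.1| ≤ r * (s / 2) := hp'.resolve_right fun h => by linarith
  exact ⟨by rw [cost_true]; exact min_eq_left (by linarith), hp2⟩

/-- Strategyproofness on a close pair: each of the two agents cannot have a report that puts `F₁`
as close to him as the other agent is. -/
lemma not_both_close (hg : PairMechanism α r ε g) (hα : 2 < α) (hr : r < α)
    (hε : 0 < ε) (hαε : α * ε ≤ 1 / 4) {p q u v : ℝ} (hp : p ∈ Set.Icc (0:ℝ) (1 / 4))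
    (hq : q ∈ Set.Icc (0:ℝ) (1 / 4)) (hne : p ≠ q) (hpq : α * |p - q| ≤ ε)
    (hu : u ∈ Set.Icc (0:ℝ) 1) (hv : v ∈ Set.Icc (0:ℝ) 1)
    (hpu : |q - (g p u).1| ≤ |p - q|) (hqv : |p - (g q v).1| ≤ |p - q|) : False := by
  have hp' : p ∈ Set.Icc (0:ℝ) 1 := ⟨hp.1, by linarith [hp.2]⟩
  have hq' : q ∈ Set.Icc (0:ℝ) 1 := ⟨hq.1, by linarith [hq.2]⟩
  have h1 := hg.cost_eq_of_near (by linarith) hr hε hαε hp hq hpq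
  have h2 := hg.cost_eq_of_near (by linarith) hr hε hαε hq hp (by rwa [abs_sub_comm])
  have h3 := (hg.cost_le p hp' q hq' v hv).trans (cost_true_le_left _ _ _)
  have h4 := (hg.cost_le q hq' p hp' u hu).trans (cost_true_le_left _ _ _)
  rw [hg.symm v q] at h3
  rw [hg.symm u p] at h4
  rw [hg.symm q p] at h2 h4
  have h5 := abs_sub_le p (g p q).2 q
  rw [abs_sub_comm (g p q).2 q] at h5
  have := abs_pos.2 (sub_ne_zero.2 hne)
  nlinarith

/-- If `F₁` serves one agent of a spread-out pair and that agent moves to `F₁`, then `F₁` stays. -/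
lemma fst_eq_of_move (hg : PairMechanism α r ε g) (hα : 1 ≤ α) (hr : r < α)
    (hε : 0 < ε) {p u : ℝ} (hp : p ∈ Set.Icc (0:ℝ) 1) (hz : (g p u).1 ∈ Set.Icc (0:ℝ) (1 / 4))
    (hu : u ∈ Set.Icc (0:ℝ) (1 / 4)) (hzu : α * ε ≤ |(g p u).1 - u|)
    (hαzu : α * |(g p u).1 - u| ≤ 1 / 4) :
    (g (g p u).1 u).1 = (g p u).1 := by
  set z := (g p u).1 with hzdef
  have h1 := (hg.cost_eq_of_far hα hr hε hz hu hzu hαzu).1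
  have h2 := (hg.cost_le z ⟨hz.1, by linarith [hz.2]⟩ u ⟨hu.1, by linarith [hu.2]⟩ p hp).trans
    (cost_true_le_left _ _ _)
  rw [h1, ← hzdef, sub_self, abs_zero] at h2
  linarith [abs_nonpos_iff.1 h2]

/-- No spread-out pair has `F₁` at the location of one of its agents. -/
lemma fst_ne (hg : PairMechanism α r ε g) (hα : 1 ≤ α) (hr : r < α) (hε : 0 < ε) {z u : ℝ}
    (hz : z ∈ Set.Icc (0:ℝ) (1 / 8)) (hu : u ∈ Set.Icc (0:ℝ) (1 / 4))
    (hzu : α * ε + ε ≤ |z - u|) (hαzu : α * |z - u| + ε ≤ 1 / 4) : (g z u).1 ≠ z := by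
  intro hgz
  obtain ⟨hz0, hz1⟩ := hz
  have hα0 : 0 < α := by linarith
  have hαε : α * ε ≤ 1 / 8 := by nlinarith [hu.1, hu.2, abs_nonneg (z - u)]
  have hε1 : ε ≤ 1 / 8 := by nlinarith
  have hz' : z ∈ Set.Icc (0:ℝ) (1 / 4) := ⟨hz0, by linarith⟩
  have hα2 : 2 < α := by
    have h := (hg.cost_eq_of_far hα hr hε hu hz' (by rw [abs_sub_comm]; linarith)
      (by rw [abs_sub_comm]; linarith)).2
    rw [hg.symm, hgz] at h
    have : 0 < |u - z| := by rw [abs_sub_comm]; nlinarith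
    nlinarith
  have hu' : u ∈ Set.Icc (0:ℝ) 1 := ⟨hu.1, by linarith [hu.2]⟩
  -- Every point just to the right of `z` still forms a spread-out pair with `u`.
  have hpert : ∀ t, z ≤ t → α * (t - z) ≤ ε → t ∈ Set.Icc (0:ℝ) (1 / 4) ∧
      α * ε ≤ |t - u| ∧ α * |t - u| ≤ 1 / 4 := by
    intro t h1 h2
    have h3 : t - z ≤ ε := by nlinarith
    have h4 := abs_sub_le z t u
    have h5 := abs_sub_le t z u
    rw [abs_sub_comm z t, abs_of_nonneg (by linarith : 0 ≤ t - z)] at h4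
    rw [abs_of_nonneg (by linarith : 0 ≤ t - z)] at h5
    exact ⟨⟨by linarith, by linarith⟩, by linarith, by nlinarith⟩
  set w := ε / (2 * α) with hw
  have hw0 : 0 < w := by positivity
  have hαw : α * w = ε / 2 := by rw [hw]; field_simp
  obtain ⟨ht, htu, hαtu⟩ := hpert (z + w) (by linarith) (by nlinarith)
  have htw := (hg.cost_eq_of_far hα hr hε ht hu htu hαtu).1
  have hclose := (hg.cost_le (z + w) ⟨ht.1, by linarith [ht.2]⟩ u hu' z
    ⟨hz0, by linarith⟩).trans (cost_true_le_left _ _ _)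
  rw [htw, hgz, add_sub_cancel_left, abs_of_pos hw0, abs_le] at hclose
  by_cases hzz : (g (z + w) u).1 = z
  · refine hg.not_both_close hα2 hr hε (by linarith) hz' ht (by linarith) ?_ hu' hu'
      (by rw [hgz, abs_sub_comm]) (by rw [hzz, sub_self, abs_zero]; exact abs_nonneg _)
    rw [sub_add_cancel_left, abs_neg, abs_of_pos hw0]
    linarith
  · have hle : z ≤ (g (z + w) u).1 := by linarith
    have hlt : α * ((g (z + w) u).1 - z) ≤ ε := by nlinarith
    obtain ⟨hz2, hz2u, hαz2u⟩ := hpert _ hle hlt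
    have hfix := hg.fst_eq_of_move hα hr hε ⟨ht.1, by linarith [ht.2]⟩ hz2 hu hz2u hαz2u
    refine hg.not_both_close hα2 hr hε (by linarith) hz' hz2 (Ne.symm hzz) ?_ hu' hu'
      (by rw [hgz, abs_sub_comm]) (by rw [hfix])
    rwa [abs_sub_comm, abs_of_nonneg (by linarith)]

lemma not_of_lt (hα : 1 ≤ α) (hr : r < α) (hε : ε = 1 / (64 * α ^ 3)) :
    ¬ PairMechanism α r ε g := by
  intro hg
  have hα0 : 0 < α := by linarith
  set s := 1 / (16 * α ^ 2) with hs
  have hs0 : 0 < s := by positivity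
  have hαs : α * (α * s) = 1 / 16 := by rw [hs]; field_simp
  have hεs : α * ε = s / 4 := by rw [hs, hε]; field_simp; norm_num
  have hε0 : 0 < ε := by rw [hε]; positivity
  have hεs' : ε ≤ s / 4 := by nlinarith
  have hαs1 : α * s ≤ 1 / 16 := by nlinarith
  have hs1 : s ≤ 1 / 16 := by nlinarith
  have h0 : (0:ℝ) ∈ Set.Icc (0:ℝ) (1 / 4) := by norm_num
  have hsI : s ∈ Set.Icc (0:ℝ) (1 / 4) := ⟨hs0.le, by linarith⟩
  have hrs : r * (s / 2) ≤ α * s / 2 := by nlinarith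
  have ha := (hg.cost_eq_of_far hα hr hε0 h0 hsI
    (by rw [zero_sub, abs_neg, abs_of_pos hs0]; linarith)
    (by rw [zero_sub, abs_neg, abs_of_pos hs0]; linarith)).2
  have hb := (hg.cost_eq_of_far hα hr hε0 hsI h0
    (by rw [sub_zero, abs_of_pos hs0]; linarith)
    (by rw [sub_zero, abs_of_pos hs0]; linarith)).2
  rw [hg.symm s 0, sub_zero, abs_of_pos hs0] at hb
  rw [zero_sub, abs_neg, zero_sub, abs_neg, abs_of_pos hs0] at ha
  have hz0 := (hg.inBox 0 s).1.1
  -- Move the agent closer to `F₁` onto it.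
  have move : ∀ p u : ℝ, p ∈ Set.Icc (0:ℝ) 1 → u ∈ Set.Icc (0:ℝ) (1 / 4) → g p u = g 0 s →
      s / 2 ≤ |(g 0 s).1 - u| → |(g 0 s).1 - u| ≤ α * s / 2 → False := by
    intro p u hp hu hpu h1 h2
    rw [abs_of_nonneg hz0] at ha
    have hz : (g 0 s).1 ∈ Set.Icc (0:ℝ) (1 / 8) := ⟨hz0, by linarith⟩
    have h3 : α * |(g 0 s).1 - u| ≤ 1 / 32 := by nlinarith
    refine hg.fst_ne hα hr hε0 hz hu (by linarith) (by linarith) ?_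
    have := hg.fst_eq_of_move hα hr hε0 hp (u := u)
    rw [hpu] at this
    exact this ⟨hz0, by linarith [hz.2]⟩ hu (by linarith) (by linarith)
  rcases le_total (s / 2) (g 0 s).1 with h | h
  · exact move s 0 ⟨hs0.le, by linarith⟩ h0 (hg.symm _ _)
      (by rw [sub_zero]; exact h.trans (le_abs_self _)) (by rw [sub_zero]; linarith)
  · exact move 0 s (by norm_num) hsI rfl
      (by rw [abs_sub_comm]; linarith [le_abs_self (s - (g 0 s).1)])
      (by rw [abs_sub_comm]; linarith)

end PairMechanism

/-- One agent at each of `p`, `q` and `1 - ε`, and all other agents at `1`. -/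
def pairLoc (n : ℕ) (ε p q : ℝ) : Loc n := fun i =>
  if i.val = 0 then p else if i.val = 1 then q else if i.val = 2 then 1 - ε else 1

lemma pairMechanism_of_mechanism {α r ε : ℝ} (hα : 1 ≤ α) (hr : 0 ≤ r) (hε0 : 0 ≤ ε) (hε1 : ε ≤ 1)
    {n : ℕ} (hn : 4 ≤ n) (f : Loc n → Pref n → ℝ × ℝ) (hbox : ∀ x σ, inBox (f x σ))
    (hanon : Anonymous f) (hSP : SPlocCost α f)
    (happrox : ∀ x : Loc n, validLoc x → ∀ σ : Pref n,
      BC α x σ (f x σ) ≤ r * optBC α x σ) :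
    PairMechanism α r ε fun p q => f (pairLoc n ε p q) fun _ => true := by
  have hα0 : 0 ≤ α := by linarith
  have hvalid : ∀ p ∈ Set.Icc (0:ℝ) 1, ∀ q ∈ Set.Icc (0:ℝ) 1, validLoc (pairLoc n ε p q) := by
    intro p hp q hq i
    unfold pairLoc
    split_ifs
    exacts [hp, hq, ⟨by linarith, by linarith⟩, by norm_num]
  refine ⟨fun p q => hbox _ _, fun p q => ?_, fun p hp q hq u hu => ?_, ?_⟩
  · rw [← hanon (pairLoc n ε p q) (fun _ => true) (Equiv.swap ⟨0, by omega⟩ ⟨1, by omega⟩)]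
    congr 1
    funext i
    simp only [Function.comp, Equiv.swap_apply_def, pairLoc, Fin.ext_iff]
    split_ifs <;> simp_all
  · have h := hSP (pairLoc n ε p q) (hvalid p hp q hq) (fun _ => true) ⟨0, by omega⟩ u hu
    have hupd : Function.update (pairLoc n ε p q) ⟨0, by omega⟩ u = pairLoc n ε u q := by
      funext i
      simp only [Function.update_apply, pairLoc, Fin.ext_iff]
      split_ifs <;> rfl
    rw [hupd] at h
    exact h
  · intro p hp q hq y B hy hB t ht
    have hBC : BC α (pairLoc n ε p q) (fun _ => true) y ≤ B := by
      have : Nonempty (Fin n) := ⟨⟨0, by omega⟩⟩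
      refine ciSup_le fun i => hB _ ?_
      unfold pairLoc
      split_ifs <;> simp
    obtain ⟨i, rfl⟩ : ∃ i, pairLoc n ε p q i = t := by
      rcases ht with rfl | rfl | rfl | rfl
      · exact ⟨⟨0, by omega⟩, by simp [pairLoc]⟩
      · exact ⟨⟨1, by omega⟩, by simp [pairLoc]⟩
      · exact ⟨⟨2, by omega⟩, by simp [pairLoc]⟩
      · exact ⟨⟨3, by omega⟩, by simp [pairLoc]⟩
    calc cost α (pairLoc n ε p q i) true _
        ≤ BC α (pairLoc n ε p q) (fun _ => true) (f (pairLoc n ε p q) fun _ => true) :=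
          cost_le_BC α _ (fun _ => true) _ i
      _ ≤ r * optBC α (pairLoc n ε p q) (fun _ => true) := happrox _ (hvalid p hp q hq) _
      _ ≤ r * B := mul_le_mul_of_nonneg_left ((optBC_le hα0 hy).trans hBC) hr

/-- With private locations and an even number `n ≥ 4` of agents, no deterministic
anonymous strategyproof mechanism has an approximation ratio less than `α` under the
maximum cost objective. -/
theorem stmt_14 (α : ℝ) (hα : 1 ≤ α) (n : ℕ) (hn : 4 ≤ n) (heven : Even n)
    (f : Loc n → Pref n → ℝ × ℝ) (hbox : ∀ x σ, inBox (f x σ))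
    (hanon : Anonymous f) (hSP : SPlocCost α f) (r : ℝ)
    (happrox : ∀ x : Loc n, validLoc x → ∀ σ : Pref n,
      BC α x σ (f x σ) ≤ r * optBC α x σ) :
    α ≤ r := by
  by_contra! hr
  have hα0 : 0 < α := by linarith
  have hε1 : 1 / (64 * α ^ 3) ≤ 1 := by
    rw [div_le_one (by positivity)]
    linarith [one_le_pow₀ hα (n := 3)]
  refine PairMechanism.not_of_lt hα (max_lt hr hα0) rfl
    (pairMechanism_of_mechanism hα (le_max_right r 0) (by positivity) hε1 hn f hbox hanon hSP
      fun x hx σ => (happrox x hx σ).trans ?_)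
  exact mul_le_mul_of_nonneg_right (le_max_left r 0) (optBC_nonneg hα0.le x σ)
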